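/- Let PΓ₀(2) = Γ₀(2)/{±I}. Then Hⁱ(PΓ₀(2), ℤ) ≅ ℤ for i = 0 and i = 1, ℤ/2 for all even i ≥ 2, and 0 for all odd i ≥ 3. Consequently, Hⁱ(Γ₀(2), ℤ) ≅ ℤ for i = 0 and i = 1, ℤ/4 for all even i ≥ 2, and ℤ/2 for all odd i ≥ 3. -/

import Mathlib

open CongruenceSubgroup

/-- `-I` as an element of `Γ₀(2)`. -/
def negIGamma0Two : Gamma0 2 :=
  ⟨-1, by rw [Gamma0_mem]; simp⟩

/-- The central subgroup `{±I}` of `Γ₀(2)`. -/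
def pmOneTwo : Subgroup (Gamma0 2) :=
  Subgroup.zpowers negIGamma0Two

instance pmOneTwo_normal : pmOneTwo.Normal := by
  have hc : ∀ g : Gamma0 2, negIGamma0Two * g = g * negIGamma0Two := by
    intro g; ext; simp [negIGamma0Two]
  refine ⟨fun x hx g => ?_⟩
  obtain ⟨n, rfl⟩ := Subgroup.mem_zpowers_iff.mp hx
  have hgm : Commute g negIGamma0Two := (hc g).symm
  have h2 : g * negIGamma0Two ^ n * g⁻¹ = negIGamma0Two ^ n := by
    rw [(hgm.zpow_right n).eq, mul_assoc, mul_inv_cancel, mul_one]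
  rw [h2]
  exact Subgroup.zpow_mem _ (Subgroup.mem_zpowers _) n

/-- The projective group `PΓ₀(2) = Γ₀(2)/{±I}`. -/
abbrev PGamma0Two := Gamma0 2 ⧸ pmOneTwo

section Helpers
open CategoryTheory

lemma cyc_even (n : ℕ) [NeZero n] (i : ℕ) (h0 : i ≠ 0) (hi : Even i) :
    Nonempty (groupCohomology (Rep.trivial ℤ (Multiplicative (ZMod n)) ℤ) i ≃ₗ[ℤ] ZMod n) := by
  have : NeZero i := ⟨h0⟩
  have hg : ∀ x : Multiplicative (ZMod n), x ∈ Subgroup.zpowers (Multiplicative.ofAdd (1 : ZMod n)) := by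
    intro x
    refine ⟨(x.toAdd.val : ℤ), ?_⟩
    apply Multiplicative.toAdd.injective
    simp
  let A := Rep.trivial ℤ (Multiplicative (ZMod n)) ℤ
  let g := Multiplicative.ofAdd (1 : ZMod n)
  let p := Rep.FiniteCyclicGroup.groupCohomologyπEven A g hg i hi
  have hker : ∀ z : ℤ, z ∈ LinearMap.ker (Rep.applyAsHom A g - 𝟙 A).hom.toLinearMap := by
    intro z
    exact sub_self z
  let q : ℤ →ₗ[ℤ] groupCohomology A i := p.hom ∘ₗ (LinearMap.codRestrict _ LinearMap.id hker)
  have hq : Function.Surjective q := by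
    have hp : Function.Surjective p := by
      rw [← ModuleCat.epi_iff_surjective]
      unfold p Rep.FiniteCyclicGroup.groupCohomologyπEven
      exact epi_comp' (@IsIso.epi_of_iso _ _ _ _ _ (Iso.isIso_inv _)) (epi_comp' inferInstance inferInstance)
    intro y
    obtain ⟨x, rfl⟩ := hp y
    exact ⟨x.1, rfl⟩
  have hqk : ∀ z, q z = 0 ↔ (n : ℤ) ∣ z := by
    intro z
    refine (Rep.FiniteCyclicGroup.groupCohomologyπEven_eq_zero_iff A g hg i hi ⟨z, hker z⟩).trans ?_
    have hN : ∀ w : ℤ, A.norm.hom.toLinearMap w = n * w := by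
      intro w
      simp [Rep.norm, Representation.norm, A]
    constructor
    · rintro ⟨w, hw⟩
      exact ⟨w, by rw [← hN]; exact hw.symm⟩
    · rintro ⟨w, hw⟩
      exact ⟨w, by rw [hN]; exact hw.symm⟩
  let r : ℤ →ₗ[ℤ] ZMod n := (Int.castAddHom (ZMod n)).toIntLinearMap
  have hr : Function.Surjective r := ZMod.intCast_surjective
  have hk : LinearMap.ker q = LinearMap.ker r := by
    ext z
    rw [LinearMap.mem_ker, LinearMap.mem_ker, hqk]
    exact (ZMod.intCast_zmod_eq_zero_iff_dvd z n).symm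
  exact ⟨(q.quotKerEquivOfSurjective hq).symm ≪≫ₗ Submodule.quotEquivOfEq _ _ hk ≪≫ₗ
    r.quotKerEquivOfSurjective hr⟩

lemma cyc_odd (n : ℕ) [NeZero n] (i : ℕ) (hi : Odd i) :
    Subsingleton (groupCohomology (Rep.trivial ℤ (Multiplicative (ZMod n)) ℤ) i) := by
  have hg : ∀ x : Multiplicative (ZMod n), x ∈ Subgroup.zpowers (Multiplicative.ofAdd (1 : ZMod n)) := by
    intro x
    refine ⟨(x.toAdd.val : ℤ), ?_⟩
    apply Multiplicative.toAdd.injective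
    simp
  let A := Rep.trivial ℤ (Multiplicative (ZMod n)) ℤ
  let g := Multiplicative.ofAdd (1 : ZMod n)
  let p := Rep.FiniteCyclicGroup.groupCohomologyπOdd A g hg i hi
  have hp : Function.Surjective p := by
    rw [← ModuleCat.epi_iff_surjective]
    unfold p Rep.FiniteCyclicGroup.groupCohomologyπOdd
    exact epi_comp' (@IsIso.epi_of_iso _ _ _ _ _ (Iso.isIso_inv _)) (epi_comp' inferInstance inferInstance)
  have hN : ∀ w : ℤ, A.norm.hom.toLinearMap w = n * w := by
    intro w
    simp [Rep.norm, Representation.norm, A]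
  have h0 : ∀ y : groupCohomology A i, y = 0 := by
    intro y
    obtain ⟨x, rfl⟩ := hp y
    have : x = 0 := by
      apply Subtype.ext
      have h1 : (n : ℤ) * (show ℤ from x.1) = 0 := (hN x.1).symm.trans x.2
      rcases mul_eq_zero.1 h1 with h | h
      · exact absurd h (by exact_mod_cast NeZero.ne n)
      · exact h
    rw [this, map_zero]
  exact ⟨fun a b => (h0 a).trans (h0 b).symm⟩

/-- Cohomology of a cyclic subgroup in terms of the standard cyclic group. -/
noncomputable def zpIso {G : Type} [Group G] (x : G) (n : ℕ) (h : orderOf x = n) (i : ℕ) :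
    groupCohomology (Rep.trivial ℤ (Multiplicative (ZMod n)) ℤ) i ≅
    groupCohomology (Rep.trivial ℤ (Subgroup.zpowers x) ℤ) i :=
  have hn : Nat.card (Subgroup.zpowers x) = n := by rw [Nat.card_zpowers, h]
  groupCohomology.mapIso (A := Rep.trivial ℤ (Subgroup.zpowers x) ℤ)
    (B := Rep.trivial ℤ (Multiplicative (ZMod n)) ℤ)
    (hn ▸ zmodCyclicMulEquiv (inferInstance : IsCyclic (Subgroup.zpowers x)))
    (LinearEquiv.refl ℤ ℤ) (fun g => rfl) i

lemma zp_even {G : Type} [Group G] (x : G) (n : ℕ) [NeZero n] (h : orderOf x = n) (i : ℕ)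
    (h0 : i ≠ 0) (hi : Even i) :
    Nonempty (groupCohomology (Rep.trivial ℤ (Subgroup.zpowers x) ℤ) i ≃ₗ[ℤ] ZMod n) := by
  obtain ⟨e⟩ := cyc_even n i h0 hi
  exact ⟨(zpIso x n h i).symm.toLinearEquiv ≪≫ₗ e⟩

lemma zp_odd {G : Type} [Group G] (x : G) (n : ℕ) [NeZero n] (h : orderOf x = n) (i : ℕ)
    (hi : Odd i) :
    Subsingleton (groupCohomology (Rep.trivial ℤ (Subgroup.zpowers x) ℤ) i) := by
  have := cyc_odd n i hi
  exact (zpIso x n h i).symm.toLinearEquiv.toEquiv.subsingleton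

/-- The coinduced module of functions on `G` invariant under left translation by `x`. -/
noncomputable abbrev coZ {G : Type} [Group G] (x : G) : Rep ℤ G :=
  Rep.coind (Subgroup.zpowers x).subtype (Rep.trivial ℤ (Subgroup.zpowers x) ℤ)

lemma coZ_even {G : Type} [Group G] (x : G) (n : ℕ) [NeZero n] (h : orderOf x = n) (i : ℕ)
    (h0 : i ≠ 0) (hi : Even i) :
    Nonempty (groupCohomology (coZ x) i ≃ₗ[ℤ] ZMod n) := by
  obtain ⟨e⟩ := zp_even x n h i h0 hi
  exact ⟨(groupCohomology.coindIso _ i).toLinearEquiv ≪≫ₗ e⟩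

lemma coZ_odd {G : Type} [Group G] (x : G) (n : ℕ) [NeZero n] (h : orderOf x = n) (i : ℕ)
    (hi : Odd i) :
    Subsingleton (groupCohomology (coZ x) i) := by
  have := zp_odd x n h i hi
  exact (groupCohomology.coindIso (Rep.trivial ℤ (Subgroup.zpowers x) ℤ) i).toLinearEquiv.toEquiv.subsingleton

lemma mem_coZ {G : Type} [Group G] (x : G) (f : G → ℤ) :
    (∀ (g : Subgroup.zpowers x) (h : G), f (g * h) = f h) ↔ ∀ h, f (x * h) = f h := by
  constructor
  · intro H h
    exact H ⟨x, Subgroup.mem_zpowers x⟩ h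
  · rintro H ⟨g, hg⟩ h
    let K : Subgroup G :=
      { carrier := {g | ∀ h, f (g * h) = f h}
        mul_mem' := by
          intro a b ha hb h
          rw [mul_assoc, ha, hb]
        one_mem' := by intro h; rw [one_mul]
        inv_mem' := by
          intro a ha h
          rw [← ha, mul_inv_cancel_left] }
    have : Subgroup.zpowers x ≤ K := by
      rw [Subgroup.zpowers_le]
      exact H
    exact this hg h

/-- Constant functions. -/
noncomputable def constMap {G : Type} [Group G] (x : G) : Rep.trivial ℤ G ℤ ⟶ coZ x :=
  Rep.ofHom ⟨LinearMap.codRestrict _ (LinearMap.pi fun _ : G => (LinearMap.id : ℤ →ₗ[ℤ] ℤ))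
    (fun _ _ _ => rfl), fun _ => rfl⟩

/-- The coboundary `f ↦ (g ↦ f (T g) - f g)` for the tree. -/
noncomputable def diffMap {G : Type} [Group G] (S T : G) (hST : Commute (S ^ 2) T) :
    coZ S ⟶ coZ (S ^ 2) :=
  Rep.ofHom ⟨LinearMap.codRestrict _
    ((LinearMap.funLeft ℤ ℤ (fun g : G => T * g) - LinearMap.id) ∘ₗ Submodule.subtype _)
    (fun f a b => (mem_coZ (S ^ 2) (fun g => f.1 (T * g) - f.1 g)).2 (fun h => by
      have hf := (mem_coZ S f.1).1 f.2
      have h2 : ∀ h, f.1 (S ^ 2 * h) = f.1 h := by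
        intro h
        rw [pow_two, mul_assoc, hf, hf]
      dsimp only
      rw [← mul_assoc, ← hST.eq, mul_assoc, h2, h2]) a b), fun g => by
        ext f h
        change f.1 (T * h * g) - f.1 (h * g) = f.1 (T * (h * g)) - f.1 (h * g)
        rw [mul_assoc]⟩

lemma constMap_apply {G : Type} [Group G] (x : G) (z : ℤ) (g : G) :
    ((constMap x).hom z).1 g = z := rfl

lemma diffMap_apply {G : Type} [Group G] (S T : G) (hST : Commute (S ^ 2) T) (f : coZ S) (g : G) :
    ((diffMap S T hST).hom f).1 g = f.1 (T * g) - f.1 g := rfl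

/-- The exact sequence of the tree. -/
noncomputable def treeSeq {G : Type} [Group G] (S T : G) (hST : Commute (S ^ 2) T) :
    ShortComplex (Rep ℤ G) where
  X₁ := Rep.trivial ℤ G ℤ
  X₂ := coZ S
  X₃ := coZ (S ^ 2)
  f := constMap S
  g := diffMap S T hST
  zero := by
    ext z
    exact sub_self (1 : ℤ)

/-- The permutation `(g, n) ↦ (x g, n + h g)` of `G × ℤ`. -/
def shiftPerm {G : Type} [Group G] (x : G) (h : G → ℤ) : Equiv.Perm (G × ℤ) where
  toFun p := (x * p.1, p.2 + h p.1)
  invFun p := (x⁻¹ * p.1, p.2 - h (x⁻¹ * p.1))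
  left_inv p := by simp
  right_inv p := by simp

lemma rep_exact {k G : Type} [CommRing k] [Group G] (X : ShortComplex (Rep.{0} k G))
    (h : ∀ x : X.X₂, X.g.hom x = 0 → ∃ y : X.X₁, X.f.hom y = x) : X.Exact := by
  rw [← ShortComplex.exact_map_iff_of_faithful _ (forget₂ (Rep.{0} k G) (ModuleCat.{0} k)),
      ShortComplex.moduleCat_exact_iff]
  exact h

lemma treeSeq_exact {G : Type} [Group G] (S T : G) (m : ℕ) (hS : S ^ (2 * m) = 1)
    (hST : Commute (S ^ 2) T) (hgen : Subgroup.closure {S, T} = ⊤)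
    (huniv : ∀ (M : Type) [Group M] (s t : M), s ^ (2 * m) = 1 → Commute (s ^ 2) t →
      ∃ φ : G →* M, φ S = s ∧ φ T = t) : (treeSeq S T hST).ShortExact where
  mono_f := by
    rw [Rep.mono_iff_injective]
    intro a b hab
    have := congrFun (congrArg Subtype.val hab) 1
    exact this
  epi_g := by
    rw [Rep.epi_iff_surjective]
    rintro ⟨h, hh⟩
    have hh := (mem_coZ _ h).1 hh
    have hs : ∀ k : ℕ, ∀ p, ((shiftPerm S 0) ^ k) p = (S ^ k * p.1, p.2) := by
      intro k
      induction k with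
      | zero => intro p; simp
      | succ k ih =>
        intro p
        rw [pow_succ', Equiv.Perm.mul_apply, ih]
        simp [shiftPerm, pow_succ', mul_assoc]
    obtain ⟨φ, h1, h2⟩ := huniv (Equiv.Perm (G × ℤ)) (shiftPerm S 0) (shiftPerm T h)
      (by
        ext1 p
        rw [hs, hS, one_mul]
        rfl)
      (by
        apply Equiv.ext
        intro p
        rw [Equiv.Perm.mul_apply, Equiv.Perm.mul_apply, hs, hs]
        simp only [shiftPerm, Equiv.coe_fn_mk, hh]
        rw [← mul_assoc, hST.eq, mul_assoc])
    let f : G → ℤ := fun g => (φ g (1, 0)).2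
    have hfst : ∀ g, ∀ p, (φ g p).1 = g * p.1 := by
      let K : Subgroup G :=
        { carrier := {g | ∀ p, (φ g p).1 = g * p.1}
          mul_mem' := by
            intro a b ha hb p
            rw [map_mul, Equiv.Perm.mul_apply, ha, hb, mul_assoc]
          one_mem' := by intro p; simp
          inv_mem' := by
            intro a ha p
            have := ha (φ a⁻¹ p)
            rw [← Equiv.Perm.mul_apply, ← map_mul, mul_inv_cancel, map_one] at this
            rw [eq_inv_mul_iff_mul_eq, ← this]
            rfl }
      have hK : K = ⊤ := by
        rw [eq_top_iff, ← hgen, Subgroup.closure_le]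
        rintro x (rfl | rfl) p
        · rw [h1]; rfl
        · rw [h2]; rfl
      intro g
      have : g ∈ K := hK ▸ Subgroup.mem_top g
      exact this
    have hfS : ∀ g, f (S * g) = f g := by
      intro g
      simp only [f, map_mul, h1, Equiv.Perm.mul_apply]
      simp [shiftPerm]
    have hfT : ∀ g, f (T * g) = f g + h g := by
      intro g
      simp only [f, map_mul, h2, Equiv.Perm.mul_apply]
      simp [shiftPerm, hfst]
    refine ⟨⟨f, (mem_coZ S f).2 hfS⟩, ?_⟩
    apply Subtype.ext
    funext g
    refine (diffMap_apply S T hST ⟨f, (mem_coZ S f).2 hfS⟩ g).trans ?_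
    change f (T * g) - f g = h g
    rw [hfT]; ring
  exact := by
    apply rep_exact
    rintro ⟨f, hf⟩ h0
    have hf := (mem_coZ _ f).1 hf
    have hT : ∀ g, f (T * g) = f g := by
      intro g
      have := congrFun (congrArg Subtype.val h0) g
      exact sub_eq_zero.1 this
    have hall : ∀ g h, f (g * h) = f h := by
      let K : Subgroup G :=
        { carrier := {g | ∀ h, f (g * h) = f h}
          mul_mem' := by
            intro a b ha hb h
            rw [mul_assoc, ha, hb]
          one_mem' := by intro h; rw [one_mul]
          inv_mem' := by
            intro a ha h
            rw [← ha, mul_inv_cancel_left] }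
      have hK : K = ⊤ := by
        rw [eq_top_iff, ← hgen, Subgroup.closure_le]
        rintro x (rfl | rfl)
        · exact hf
        · exact hT
      intro g
      have : g ∈ K := hK ▸ Subgroup.mem_top g
      exact this
    refine ⟨f 1, ?_⟩
    apply Subtype.ext
    funext g
    change f 1 = f g
    rw [← hall g 1, mul_one]


lemma abstract_cohomology {G : Type} [Group G] (S T : G) (m : ℕ) [NeZero m]
    (hS : S ^ (2 * m) = 1)
    (hST : Commute (S ^ 2) T) (hgen : Subgroup.closure {S, T} = ⊤)
    (huniv : ∀ (M : Type) [Group M] (s t : M), s ^ (2 * m) = 1 → Commute (s ^ 2) t →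
      ∃ φ : G →* M, φ S = s ∧ φ T = t) :
    Nonempty ((groupCohomology (Rep.trivial ℤ G ℤ) 0) ≃ₗ[ℤ] ℤ) ∧
     Nonempty ((groupCohomology (Rep.trivial ℤ G ℤ) 1) ≃ₗ[ℤ] ℤ) ∧
     (∀ i : ℕ, 2 ≤ i → i % 2 = 0 →
       Nonempty ((groupCohomology (Rep.trivial ℤ G ℤ) i) ≃ₗ[ℤ] ZMod (2 * m))) ∧
     (∀ i : ℕ, 3 ≤ i → i % 2 = 1 →
       Nonempty ((groupCohomology (Rep.trivial ℤ G ℤ) i) ≃ₗ[ℤ] ZMod m)) := by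
  have hm : m ≠ 0 := NeZero.ne m
  have : NeZero (2 * m) := ⟨by omega⟩
  -- orders
  have hoS : orderOf S = 2 * m := by
    apply Nat.dvd_antisymm (orderOf_dvd_of_pow_eq_one hS)
    obtain ⟨φ, h1, -⟩ := huniv (Multiplicative (ZMod (2 * m))) (Multiplicative.ofAdd 1) 1
      (by rw [← ofAdd_nsmul]; simp) (Commute.one_right _)
    have h2 := orderOf_map_dvd φ S
    rw [h1, orderOf_ofAdd_eq_addOrderOf, ZMod.addOrderOf_one] at h2
    exact h2
  have hoS2 : orderOf (S ^ 2) = m := by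
    rw [orderOf_pow' S (by norm_num), hoS]
    simp
  have hX := treeSeq_exact S T m hS hST hgen huniv
  -- injectivity of `H^i(G, ℤ) → H^i(G, coZ S)` in even degrees, and bijectivity
  have hbij : ∀ j : ℕ, Odd j → Function.Bijective
      ((groupCohomology.functor ℤ G (j + 1)).map (treeSeq S T hST).f) := by
    intro j hj
    have hje : Even (j + 1) := hj.add_one
    obtain ⟨e2⟩ := coZ_even S (2 * m) hoS (j + 1) (by omega) hje
    obtain ⟨e1⟩ := zp_even S (2 * m) hoS (j + 1) (by omega) hje
    have hsub := coZ_odd (S ^ 2) m hoS2 j hj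
    have hinj : Function.Injective
        ((groupCohomology.functor ℤ G (j + 1)).map (treeSeq S T hST).f) := by
      have hex := groupCohomology.mapShortComplex₁_exact hX (i := j) (j := j + 1) rfl
      rw [ShortComplex.moduleCat_exact_iff] at hex
      rw [injective_iff_map_eq_zero]
      intro x hx
      obtain ⟨y, hy⟩ := hex x hx
      have hy0 : y = 0 := hsub.elim _ _
      rw [← hy, hy0, map_zero]
      rfl
    -- the retraction
    obtain ⟨π, hπ, -⟩ := huniv (Subgroup.zpowers S) ⟨S, Subgroup.mem_zpowers S⟩ 1
      (by apply Subtype.ext; simpa using hS) (Commute.one_right _)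
    have hcomp : π.comp (Subgroup.zpowers S).subtype = MonoidHom.id _ := by
      ext ⟨x, k, rfl⟩
      simp [hπ]
    let a : Rep.res π (Rep.trivial ℤ (Subgroup.zpowers S) ℤ) ⟶ Rep.trivial ℤ G ℤ :=
      Rep.ofHom ⟨LinearMap.id, fun _ => rfl⟩
    let b : Rep.res (Subgroup.zpowers S).subtype (Rep.trivial ℤ G ℤ) ⟶
      Rep.trivial ℤ (Subgroup.zpowers S) ℤ := Rep.ofHom ⟨LinearMap.id, fun _ => rfl⟩
    have hab : groupCohomology.map π a (j + 1) ≫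
        groupCohomology.map (Subgroup.zpowers S).subtype b (j + 1) = 𝟙 _ := by
      rw [← groupCohomology.map_comp, ← groupCohomology.map_id]
      exact groupCohomology.map_congr hcomp rfl _
    have hinj2 : Function.Injective (groupCohomology.map π a (j + 1)) := by
      intro x y hxy
      have h1 := congrArg (groupCohomology.map (Subgroup.zpowers S).subtype b (j + 1)) hxy
      rw [← ModuleCat.comp_apply, ← ModuleCat.comp_apply, hab] at h1
      exact h1
    -- the composite is an injective self map of a finite set
    let c : ZMod (2 * m) → ZMod (2 * m) := fun z =>
      e2 ((groupCohomology.functor ℤ G (j + 1)).map (treeSeq S T hST).f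
        (groupCohomology.map π a (j + 1) (e1.symm z)))
    have hc : Function.Injective c :=
      e2.injective.comp (hinj.comp (hinj2.comp e1.symm.injective))
    have hcs : Function.Surjective c := Finite.surjective_of_injective hc
    refine ⟨hinj, fun y => ?_⟩
    obtain ⟨z, hz⟩ := hcs (e2 y)
    exact ⟨_, e2.injective hz⟩
  refine ⟨⟨(groupCohomology.H0IsoOfIsTrivial (Rep.trivial ℤ G ℤ)).toLinearEquiv⟩, ?_, ?_, ?_⟩
  · -- degree one
    let ev : (Additive G →+ ℤ) →ₗ[ℤ] ℤ :=
      { toFun := fun f => f (Additive.ofMul T)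
        map_add' := fun _ _ => rfl
        map_smul' := fun _ _ => rfl }
    have hev : Function.Bijective ev := by
      constructor
      · rw [injective_iff_map_eq_zero]
        intro f hf
        have hfS : f (Additive.ofMul S) = 0 := by
          have h1 : f (Additive.ofMul (S ^ (2 * m))) = 0 := by rw [hS]; exact map_zero f
          rw [ofMul_pow, map_nsmul, smul_eq_zero] at h1
          rcases h1 with h1 | h1
          · omega
          · exact h1
        have h1 : (AddMonoidHom.toMultiplicativeRight f) = (1 : G →* Multiplicative ℤ) := by
          apply MonoidHom.eq_of_eqOn_dense hgen
          rintro x (rfl | rfl)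
          · exact hfS
          · exact hf
        ext x
        exact DFunLike.congr_fun h1 x
      · intro z
        obtain ⟨φ, -, h2⟩ := huniv (Multiplicative ℤ) 1 (Multiplicative.ofAdd z) (one_pow _)
          (by rw [one_pow]; exact Commute.one_left _)
        refine ⟨MonoidHom.toAdditiveLeft φ, ?_⟩
        exact congrArg Multiplicative.toAdd h2
    exact ⟨(groupCohomology.H1IsoOfIsTrivial (Rep.trivial ℤ G ℤ)).toLinearEquiv ≪≫ₗ
      LinearEquiv.ofBijective ev hev⟩
  · -- even degrees
    intro i hi hi2
    obtain ⟨j, rfl⟩ : ∃ j, i = j + 1 := ⟨i - 1, by omega⟩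
    have hj : Odd j := by rw [Nat.odd_iff]; omega
    obtain ⟨e2⟩ := coZ_even S (2 * m) hoS (j + 1) (by omega) hj.add_one
    exact ⟨LinearEquiv.ofBijective
      ((groupCohomology.functor ℤ G (j + 1)).map (treeSeq S T hST).f).hom (hbij j hj) ≪≫ₗ e2⟩
  · -- odd degrees
    intro i hi hi2
    obtain ⟨j, rfl⟩ : ∃ j, i = j + 2 := ⟨i - 2, by omega⟩
    have hj : Odd j := by rw [Nat.odd_iff]; omega
    obtain ⟨e3⟩ := coZ_even (S ^ 2) m hoS2 (j + 1) (by omega) hj.add_one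
    have hsub := coZ_odd S (2 * m) hoS (j + 2) (hj.add_even (by decide))
    have hδ : Function.Bijective (groupCohomology.δ hX (j + 1) (j + 2) rfl) := by
      constructor
      · have hex := groupCohomology.mapShortComplex₃_exact hX (i := j + 1) (j := j + 2) rfl
        rw [ShortComplex.moduleCat_exact_iff] at hex
        rw [injective_iff_map_eq_zero]
        intro x hx
        obtain ⟨y, hy⟩ := hex x hx
        obtain ⟨w, hw⟩ := (hbij j hj).2 y
        rw [← hy, ← hw]
        have h0 := (groupCohomology.mapShortComplex₂ (treeSeq S T hST) (j + 1)).zero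
        exact congrArg (fun f => f.hom w) h0
      · have hex := groupCohomology.mapShortComplex₁_exact hX (i := j + 1) (j := j + 2) rfl
        rw [ShortComplex.moduleCat_exact_iff] at hex
        intro x
        exact hex x (hsub.elim _ _)
    exact ⟨(LinearEquiv.ofBijective (groupCohomology.δ hX (j + 1) (j + 2) rfl).hom hδ).symm ≪≫ₗ e3⟩


/-- The floor of the rational number `a / c`. -/
def flq (a c : ℤ) : ℤ := if 0 < c then a / c else (-a) / (-c)

lemma flq_neg (a c : ℤ) (hc : c ≠ 0) : flq (-a) (-c) = flq a c := by
  unfold flq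
  rcases lt_or_gt_of_ne hc with h | h
  · rw [if_pos (by omega), if_neg (by omega)]
  · rw [if_neg (by omega), if_pos h, neg_neg, neg_neg]

lemma flq_add (a c : ℤ) (hc : c ≠ 0) : flq (a + c) c = flq a c + 1 := by
  unfold flq
  rcases lt_or_gt_of_ne hc with h | h
  · rw [if_neg (by omega), if_neg (by omega), neg_add, Int.add_ediv_of_dvd_right (dvd_refl _),
      Int.ediv_self (by omega)]
  · rw [if_pos h, if_pos h, Int.add_ediv_of_dvd_right (dvd_refl _), Int.ediv_self hc]

lemma flq_spec (a c : ℤ) (hc : c ≠ 0) :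
    (0 < c ∧ 0 ≤ a - flq a c * c ∧ a - flq a c * c < c) ∨
    (c < 0 ∧ a - flq a c * c ≤ 0 ∧ c < a - flq a c * c) := by
  unfold flq
  rcases lt_or_gt_of_ne hc with h | h
  · right
    rw [if_neg (by omega)]
    have h1 := Int.emod_add_mul_ediv (-a) (-c)
    have h2 := Int.emod_nonneg (-a) (b := -c) (by omega)
    have h3 := Int.emod_lt_of_pos (-a) (b := -c) (by omega)
    refine ⟨h, ?_, ?_⟩ <;> linarith
  · left
    rw [if_pos h]
    have h1 := Int.emod_add_mul_ediv a c
    have h2 := Int.emod_nonneg a (b := c) (by omega)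
    have h3 := Int.emod_lt_of_pos a (b := c) (by omega)
    refine ⟨h, ?_, ?_⟩ <;> linarith

lemma flq_eq_zero (a c : ℤ) (h : (0 < c ∧ 0 ≤ a ∧ a < c) ∨ (c < 0 ∧ a ≤ 0 ∧ c < a)) :
    flq a c = 0 := by
  unfold flq
  rcases h with ⟨h, h1, h2⟩ | ⟨h, h1, h2⟩
  · rw [if_pos h, Int.ediv_eq_zero_of_lt h1 h2]
  · rw [if_neg (by omega), Int.ediv_eq_zero_of_lt (by omega) (by omega)]

/-- The element `(1, -1; 2, -1)` of order four. -/
def gS : Gamma0 2 := ⟨⟨!![1, -1; 2, -1], by simp [Matrix.det_fin_two]⟩, by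
  refine Gamma0_mem.2 ?_
  change ((2 : ℤ) : ZMod 2) = 0
  decide⟩

/-- The translation `(1, 1; 0, 1)`. -/
def gT : Gamma0 2 := ⟨ModularGroup.T, by
  rw [Gamma0_mem]; simp [ModularGroup.T]⟩

/-- The upper left entry. -/
def eA (g : Gamma0 2) : ℤ := g.1.1 0 0
/-- The upper right entry. -/
def eB (g : Gamma0 2) : ℤ := g.1.1 0 1
/-- The lower left entry. -/
def eC (g : Gamma0 2) : ℤ := g.1.1 1 0
/-- The lower right entry. -/
def eD (g : Gamma0 2) : ℤ := g.1.1 1 1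

lemma e_ext (g h : Gamma0 2) (h1 : eA g = eA h) (h2 : eB g = eB h) (h3 : eC g = eC h)
    (h4 : eD g = eD h) : g = h := by
  apply Subtype.ext
  apply Subtype.ext
  ext i j
  fin_cases i <;> fin_cases j
  · exact h1
  · exact h2
  · exact h3
  · exact h4

lemma e_det (g : Gamma0 2) : eA g * eD g - eB g * eC g = 1 := by
  have := g.1.2
  rwa [Matrix.det_fin_two] at this

lemma eC_even (g : Gamma0 2) : ∃ k, eC g = 2 * k := by
  have := g.2
  rw [Gamma0_mem] at this
  exact (ZMod.intCast_zmod_eq_zero_iff_dvd _ 2).1 this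

lemma eA_odd (g : Gamma0 2) : ∃ k, eA g = 2 * k + 1 := by
  have h1 := e_det g
  obtain ⟨k, hk⟩ := eC_even g
  rcases Int.even_or_odd' (eA g) with ⟨l, hl | hl⟩
  · exfalso
    rw [hk, hl] at h1
    have : 2 * (l * eD g - eB g * k) = 1 := by linarith
    omega
  · exact ⟨l, hl⟩

lemma eA_mul (g h : Gamma0 2) : eA (g * h) = eA g * eA h + eB g * eC h := by
  simp [eA, eB, eC, Matrix.mul_apply, Fin.sum_univ_two]
lemma eB_mul (g h : Gamma0 2) : eB (g * h) = eA g * eB h + eB g * eD h := by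
  simp [eA, eB, eD, Matrix.mul_apply, Fin.sum_univ_two]
lemma eC_mul (g h : Gamma0 2) : eC (g * h) = eC g * eA h + eD g * eC h := by
  simp [eA, eC, eD, Matrix.mul_apply, Fin.sum_univ_two]
lemma eD_mul (g h : Gamma0 2) : eD (g * h) = eC g * eB h + eD g * eD h := by
  simp [eB, eC, eD, Matrix.mul_apply, Fin.sum_univ_two]

lemma gS_e : eA gS = 1 ∧ eB gS = -1 ∧ eC gS = 2 ∧ eD gS = -1 := ⟨rfl, rfl, rfl, rfl⟩
lemma gZ_e : eA negIGamma0Two = -1 ∧ eB negIGamma0Two = 0 ∧ eC negIGamma0Two = 0 ∧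
    eD negIGamma0Two = -1 := by
  simp [eA, eB, eC, eD, negIGamma0Two]
lemma one_e : eA 1 = 1 ∧ eB 1 = 0 ∧ eC 1 = 0 ∧ eD 1 = 1 := by
  simp [eA, eB, eC, eD]
lemma gT_e (k : ℤ) : eA (gT ^ k) = 1 ∧ eB (gT ^ k) = k ∧ eC (gT ^ k) = 0 ∧ eD (gT ^ k) = 1 := by
  simp [eA, eB, eC, eD, gT, ModularGroup.coe_T_zpow]
lemma gT_e1 : eA gT = 1 ∧ eB gT = 1 ∧ eC gT = 0 ∧ eD gT = 1 := by
  simpa using gT_e 1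

lemma gS_sq : gS ^ 2 = negIGamma0Two := by
  obtain ⟨a, b, c, d⟩ := gS_e
  obtain ⟨a', b', c', d'⟩ := gZ_e
  rw [pow_two]
  apply e_ext <;> simp only [eA_mul, eB_mul, eC_mul, eD_mul, a, b, c, d, a', b', c', d'] <;> norm_num

lemma gS_inv : gS⁻¹ = negIGamma0Two * gS := by
  have h : negIGamma0Two * negIGamma0Two = 1 := by
    obtain ⟨a, b, c, d⟩ := one_e
    obtain ⟨a', b', c', d'⟩ := gZ_e
    apply e_ext <;> simp only [eA_mul, eB_mul, eC_mul, eD_mul, a, b, c, d, a', b', c', d'] <;> norm_num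
  rw [inv_eq_iff_mul_eq_one, ← mul_assoc]
  rw [← gS_sq] at h ⊢
  rw [← h]
  group

lemma gS_inv_e : eA gS⁻¹ = -1 ∧ eB gS⁻¹ = 1 ∧ eC gS⁻¹ = -2 ∧ eD gS⁻¹ = 1 := by
  obtain ⟨a, b, c, d⟩ := gS_e
  obtain ⟨a', b', c', d'⟩ := gZ_e
  rw [gS_inv]
  simp only [eA_mul, eB_mul, eC_mul, eD_mul, a, b, c, d, a', b', c', d']; norm_num

/-- One step of the Euclidean algorithm. -/
def redu (g : Gamma0 2) : Gamma0 2 := gS⁻¹ * (gT ^ (-flq (eA g) (eC g)) * g)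

lemma eC_redu (g : Gamma0 2) : eC (redu g) = eC g - 2 * (eA g - flq (eA g) (eC g) * eC g) := by
  obtain ⟨a, b, c, d⟩ := gS_inv_e
  obtain ⟨a', b', c', d'⟩ := gT_e (-flq (eA g) (eC g))
  unfold redu
  simp only [eA_mul, eC_mul, a, b, c, d, a', b', c', d']; ring

lemma redu_lt (g : Gamma0 2) (hc : eC g ≠ 0) : (eC (redu g)).natAbs < (eC g).natAbs := by
  rw [eC_redu]
  have h := flq_spec (eA g) (eC g) hc
  obtain ⟨k, hk⟩ := eC_even g
  obtain ⟨l, hl⟩ := eA_odd g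
  have h0 : eA g - flq (eA g) (eC g) * eC g ≠ 0 := by
    intro h1
    rw [hl, hk] at h1
    have : 2 * (flq (2 * l + 1) (2 * k) * k - l) = 1 := by linarith
    omega
  omega

lemma redu_neg (g : Gamma0 2) (hc : eC g ≠ 0) :
    redu (negIGamma0Two * g) = negIGamma0Two * redu g := by
  obtain ⟨a', b', c', d'⟩ := gZ_e
  have hz : ∀ x, x * negIGamma0Two = negIGamma0Two * x := by
    intro x
    apply e_ext <;> simp only [eA_mul, eB_mul, eC_mul, eD_mul, a', b', c', d'] <;> ring
  have h : flq (eA (negIGamma0Two * g)) (eC (negIGamma0Two * g)) = flq (eA g) (eC g) := by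
    rw [← flq_neg _ _ hc]
    simp only [eA_mul, eC_mul, a', b', c', d']
    congr 1 <;> ring
  unfold redu
  rw [h, ← mul_assoc _ negIGamma0Two g, hz, ← mul_assoc negIGamma0Two gS⁻¹, ← hz gS⁻¹]
  simp only [mul_assoc]

lemma redu_T (g : Gamma0 2) (hc : eC g ≠ 0) :
    flq (eA (gT * g)) (eC (gT * g)) = flq (eA g) (eC g) + 1 ∧ redu (gT * g) = redu g := by
  obtain ⟨a', b', c', d'⟩ := gT_e1
  have h : flq (eA (gT * g)) (eC (gT * g)) = flq (eA g) (eC g) + 1 := by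
    rw [← flq_add _ _ hc]
    simp only [eA_mul, eC_mul, a', b', c', d']
    congr 1 <;> ring
  refine ⟨h, ?_⟩
  unfold redu
  rw [h]
  group

section Recursion
variable {M : Type} [Group M] (s t : M)

/-- The homomorphism out of `Γ₀(2)` with prescribed values on the generators, defined by
Euclidean recursion. -/
def phi (g : Gamma0 2) : M :=
  if h : eC g = 0 then (if eA g = 1 then 1 else s ^ 2) * t ^ (eA g * eB g)
  else t ^ (flq (eA g) (eC g)) * (s * phi (redu g))
termination_by (eC g).natAbs
decreasing_by exact redu_lt g h

lemma phi_zero (g : Gamma0 2) (h : eC g = 0) :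
    phi s t g = (if eA g = 1 then 1 else s ^ 2) * t ^ (eA g * eB g) := by
  rw [phi, dif_pos h]

lemma phi_ne (g : Gamma0 2) (h : eC g ≠ 0) :
    phi s t g = t ^ (flq (eA g) (eC g)) * (s * phi s t (redu g)) := by
  rw [phi, dif_neg h]

lemma eA_of_eC (g : Gamma0 2) (h : eC g = 0) : (eA g = 1 ∧ eD g = 1) ∨ (eA g = -1 ∧ eD g = -1) := by
  have h1 := e_det g
  rw [h, mul_zero, sub_zero] at h1
  exact Int.mul_eq_one_iff_eq_one_or_neg_one.1 h1

variable (h4 : s ^ 4 = 1) (hc : Commute (s ^ 2) t)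
include hc

lemma phi_T (g : Gamma0 2) : phi s t (gT * g) = t * phi s t g := by
  obtain ⟨a', b', c', d'⟩ := gT_e1
  have hC : eC (gT * g) = eC g := by simp only [eC_mul, c', d']; ring
  by_cases h : eC g = 0
  · rw [phi_zero _ _ _ h, phi_zero _ _ _ (hC.trans h)]
    have hA : eA (gT * g) = eA g := by simp only [eA_mul, a', b', h]; ring
    have hB : eB (gT * g) = eB g + eD g := by simp only [eB_mul, a', b']; ring
    rw [hA, hB]
    have hE : eA g * (eB g + eD g) = 1 + eA g * eB g := by
      have := e_det g
      rw [h] at this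
      linarith
    rw [hE, zpow_add, zpow_one, ← mul_assoc, ← mul_assoc]
    congr 1
    split_ifs
    · simp
    · exact hc.eq
  · obtain ⟨h1, h2⟩ := redu_T g h
    rw [phi_ne _ _ _ h, phi_ne _ _ _ (hC ▸ h), h1, h2, add_comm, zpow_add, zpow_one, mul_assoc]

include h4

lemma phi_Z (g : Gamma0 2) : phi s t (negIGamma0Two * g) = s ^ 2 * phi s t g := by
  obtain ⟨a', b', c', d'⟩ := gZ_e
  induction hn : (eC g).natAbs using Nat.strong_induction_on generalizing g with
  | _ n ih =>
    have hA : eA (negIGamma0Two * g) = -eA g := by simp only [eA_mul, a', b']; ring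
    have hB : eB (negIGamma0Two * g) = -eB g := by simp only [eB_mul, a', b']; ring
    have hC : eC (negIGamma0Two * g) = -eC g := by simp only [eC_mul, c', d']; ring
    by_cases h : eC g = 0
    · rw [phi_zero _ _ _ h, phi_zero _ _ _ (by rw [hC, h, neg_zero]), hA, hB, neg_mul_neg,
        ← mul_assoc]
      congr 1
      rcases eA_of_eC g h with ⟨h1, -⟩ | ⟨h1, -⟩
      · rw [h1]; simp
      · rw [h1, if_pos (by norm_num), if_neg (by norm_num), ← pow_add, h4]
    · rw [phi_ne _ _ _ h, phi_ne _ _ _ (by rw [hC]; simpa using h), hA, hC, flq_neg _ _ h,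
        redu_neg g h, ih _ (hn ▸ redu_lt g h) _ rfl]
      have h1 := (hc.zpow_right (flq (eA g) (eC g))).eq
      rw [← mul_assoc (s ^ 2), h1, mul_assoc]
      congr 1
      simp only [pow_two, mul_assoc]

lemma phi_S (g : Gamma0 2) : phi s t (gS * g) = s * phi s t g := by
  obtain ⟨a', b', c', d'⟩ := gS_e
  have hA : eA (gS * g) = eA g - eC g := by simp only [eA_mul, a', b']; ring
  have hC : eC (gS * g) = 2 * eA g - eC g := by simp only [eC_mul, c', d']; ring
  obtain ⟨k, hk⟩ := eC_even g
  obtain ⟨l, hl⟩ := eA_odd g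
  by_cases h : eC g ≠ 0 ∧ flq (eA g) (eC g) = 0
  · have h1 : gS * g = negIGamma0Two * redu g := by
      unfold redu
      rw [h.2, ← gS_sq]
      group
    rw [h1, phi_Z s t h4 hc, phi_ne _ _ g h.1, h.2]
    simp only [zpow_zero, one_mul, pow_two, mul_assoc]
  · have h0 : ¬ ((0 < eC g ∧ 0 ≤ eA g ∧ eA g < eC g) ∨ (eC g < 0 ∧ eA g ≤ 0 ∧ eC g < eA g)) := by
      intro h2
      exact h ⟨by omega, flq_eq_zero _ _ h2⟩
    have hC0 : eC (gS * g) ≠ 0 := by rw [hC]; omega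
    have hf : flq (eA (gS * g)) (eC (gS * g)) = 0 := by
      apply flq_eq_zero
      rw [hA, hC]
      omega
    have hr : redu (gS * g) = g := by
      unfold redu
      rw [hf]
      group
    rw [phi_ne _ _ _ hC0, hr, hf, zpow_zero, one_mul]

end Recursion

lemma gST_gen : Subgroup.closure {gS, gT} = ⊤ := by
  have hSm : gS ∈ Subgroup.closure {gS, gT} := Subgroup.subset_closure (by simp)
  have hTm : gT ∈ Subgroup.closure {gS, gT} := Subgroup.subset_closure (by simp)
  rw [eq_top_iff]
  intro g _
  induction hn : (eC g).natAbs using Nat.strong_induction_on generalizing g with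
  | _ n ih =>
    by_cases h : eC g = 0
    · obtain ⟨a, b, c, d⟩ := gT_e (eA g * eB g)
      obtain ⟨a', b', c', d'⟩ := gZ_e
      rcases eA_of_eC g h with ⟨h1, h2⟩ | ⟨h1, h2⟩
      · have : g = gT ^ (eA g * eB g) := by
          apply e_ext
          · rw [a, h1]
          · rw [b, h1, one_mul]
          · rw [c, h]
          · rw [d, h2]
        rw [this]
        exact Subgroup.zpow_mem _ hTm _
      · have : g = gS ^ 2 * gT ^ (eA g * eB g) := by
          rw [gS_sq]
          apply e_ext
          · rw [eA_mul, a, c, a', b', h1]; ring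
          · rw [eB_mul, b, d, a', b', h1]; ring
          · rw [eC_mul, a, c, c', d', h]; ring
          · rw [eD_mul, b, d, c', d', h2]; ring
        rw [this]
        exact Subgroup.mul_mem _ (Subgroup.pow_mem _ hSm _) (Subgroup.zpow_mem _ hTm _)
    · have h1 := ih _ (hn ▸ redu_lt g h) (Subgroup.mem_top (redu g)) rfl
      have h2 : g = gT ^ (flq (eA g) (eC g)) * (gS * redu g) := by
        unfold redu
        group
      rw [h2]
      exact Subgroup.mul_mem _ (Subgroup.zpow_mem _ hTm _) (Subgroup.mul_mem _ hSm h1)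

lemma gamma_univ (M : Type) [Group M] (s t : M) (h4 : s ^ 4 = 1) (hc : Commute (s ^ 2) t) :
    ∃ φ : Gamma0 2 →* M, φ gS = s ∧ φ gT = t := by
  have h1 : phi s t 1 = 1 := by
    obtain ⟨a, b, c, d⟩ := one_e
    rw [phi_zero _ _ _ c, a, b]
    simp
  let K : Subgroup (Gamma0 2) :=
    { carrier := {g | ∃ u : M, ∀ h, phi s t (g * h) = u * phi s t h}
      mul_mem' := by
        rintro a b ⟨u, hu⟩ ⟨v, hv⟩
        exact ⟨u * v, fun h => by rw [mul_assoc, hu, hv, mul_assoc]⟩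
      one_mem' := ⟨1, fun h => by rw [one_mul, one_mul]⟩
      inv_mem' := by
        rintro a ⟨u, hu⟩
        refine ⟨u⁻¹, fun h => ?_⟩
        rw [eq_inv_mul_iff_mul_eq, ← hu, mul_inv_cancel_left] }
  have hK : K = ⊤ := by
    rw [eq_top_iff, ← gST_gen, Subgroup.closure_le]
    rintro x (rfl | rfl)
    · exact ⟨s, phi_S s t h4 hc⟩
    · exact ⟨t, phi_T s t hc⟩
  have hmul : ∀ g h, phi s t (g * h) = phi s t g * phi s t h := by
    intro g h
    have : g ∈ K := hK ▸ Subgroup.mem_top g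
    obtain ⟨u, hu⟩ := this
    have h2 := hu 1
    rw [mul_one, h1, mul_one] at h2
    rw [hu, h2]
  refine ⟨⟨⟨phi s t, h1⟩, hmul⟩, ?_, ?_⟩
  · have := phi_S s t h4 hc 1
    rw [mul_one, h1, mul_one] at this
    exact this
  · have := phi_T s t hc 1
    rw [mul_one, h1, mul_one] at this
    exact this

lemma gS_four : gS ^ 4 = 1 := by
  have h : negIGamma0Two ^ 2 = 1 := by
    obtain ⟨a, b, c, d⟩ := one_e
    obtain ⟨a', b', c', d'⟩ := gZ_e
    rw [pow_two]
    apply e_ext <;> simp only [eA_mul, eB_mul, eC_mul, eD_mul, a, b, c, d, a', b', c', d'] <;> norm_num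
  rw [show 4 = 2 * 2 from rfl, pow_mul, gS_sq, h]

lemma gST_comm : Commute (gS ^ 2) gT := by
  obtain ⟨a, b, c, d⟩ := gT_e1
  obtain ⟨a', b', c', d'⟩ := gZ_e
  rw [gS_sq]
  apply e_ext <;> simp only [eA_mul, eB_mul, eC_mul, eD_mul, a, b, c, d, a', b', c', d'] <;> norm_num


end Helpers

/-- The integral cohomology of `PΓ₀(2)` is `ℤ` in degrees 0 and 1, `ℤ/2` in positive
even degrees, and vanishes in odd degrees `≥ 3`; consequently the integral cohomology
of `Γ₀(2)` is `ℤ` in degrees 0 and 1, `ℤ/4` in positive even degrees, and `ℤ/2` in odd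
degrees `≥ 3`. -/
theorem cohomology_PGamma0_two_and_Gamma0_two :
    (Nonempty ((groupCohomology (Rep.trivial ℤ PGamma0Two ℤ) 0) ≃ₗ[ℤ] ℤ) ∧
     Nonempty ((groupCohomology (Rep.trivial ℤ PGamma0Two ℤ) 1) ≃ₗ[ℤ] ℤ) ∧
     (∀ i : ℕ, 2 ≤ i → i % 2 = 0 →
       Nonempty ((groupCohomology (Rep.trivial ℤ PGamma0Two ℤ) i) ≃ₗ[ℤ] ZMod 2)) ∧
     (∀ i : ℕ, 3 ≤ i → i % 2 = 1 →
       Subsingleton (groupCohomology (Rep.trivial ℤ PGamma0Two ℤ) i))) ∧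
    (Nonempty ((groupCohomology (Rep.trivial ℤ (Gamma0 2) ℤ) 0) ≃ₗ[ℤ] ℤ) ∧
     Nonempty ((groupCohomology (Rep.trivial ℤ (Gamma0 2) ℤ) 1) ≃ₗ[ℤ] ℤ) ∧
     (∀ i : ℕ, 2 ≤ i → i % 2 = 0 →
       Nonempty ((groupCohomology (Rep.trivial ℤ (Gamma0 2) ℤ) i) ≃ₗ[ℤ] ZMod 4)) ∧
     (∀ i : ℕ, 3 ≤ i → i % 2 = 1 →
       Nonempty ((groupCohomology (Rep.trivial ℤ (Gamma0 2) ℤ) i) ≃ₗ[ℤ] ZMod 2))) := by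
  constructor
  · have hS2 : (QuotientGroup.mk gS : PGamma0Two) ^ 2 = 1 := by
      rw [← QuotientGroup.mk_pow, gS_sq, QuotientGroup.eq_one_iff]
      exact Subgroup.mem_zpowers _
    have h := abstract_cohomology (G := PGamma0Two) (QuotientGroup.mk gS) (QuotientGroup.mk gT) 1
      hS2 (by rw [hS2]; exact Commute.one_left _)
      (by
        have h1 := congrArg (Subgroup.map (QuotientGroup.mk' pmOneTwo)) gST_gen
        rw [MonoidHom.map_closure, Subgroup.map_top_of_surjective _
          (QuotientGroup.mk'_surjective _), Set.image_pair] at h1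
        exact h1)
      (by
        intro M _ s t hs _
        have hs2 : s ^ 2 = 1 := hs
        obtain ⟨φ, h1, h2⟩ := gamma_univ M s t
          (by rw [show 4 = 2 * 2 from rfl, pow_mul, hs2, one_pow])
          (by rw [hs2]; exact Commute.one_left _)
        refine ⟨QuotientGroup.lift pmOneTwo φ ?_, h1, h2⟩
        have : pmOneTwo ≤ φ.ker := by
          unfold pmOneTwo
          rw [Subgroup.zpowers_le, MonoidHom.mem_ker, ← gS_sq, map_pow, h1, hs2]
        intro a ha
        exact this ha)
    obtain ⟨h0, h1, h2, h3⟩ := h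
    refine ⟨h0, h1, h2, fun i hi hi2 => ?_⟩
    obtain ⟨e⟩ := h3 i hi hi2
    exact e.toEquiv.subsingleton
  · exact abstract_cohomology (G := Gamma0 2) gS gT 2 gS_four gST_comm gST_gen
      (fun M _ s t hs ht => gamma_univ M s t hs ht)
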